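/- Let (X,d) be a metric space, p ∈ [1,∞), and (Ω, F, ρ) a probability space. Let (μ_c)_{c∈Ω} and (ν_c)_{c∈Ω} be measurable families of probability measures on X with finite p-th moments. Then W_p(∫ μ_c dρ(c), ∫ ν_c dρ(c)) ≤ (∫ W_p(μ_c, ν_c)^p dρ(c))^{1/p}. -/

import Mathlib

open MeasureTheory ENNReal

/-- The `p`-Wasserstein distance between two measures on an (extended) metric space,
defined as the infimum over couplings of the `p`-th cost, raised to the power `1/p`. -/
noncomputable def wassersteinP {X : Type*} [MeasurableSpace X] [PseudoEMetricSpace X]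
    (p : ℝ) (μ ν : Measure X) : ℝ≥0∞ :=
  (⨅ π ∈ {π : Measure (X × X) | π.map Prod.fst = μ ∧ π.map Prod.snd = ν},
      ∫⁻ z, edist z.1 z.2 ^ p ∂π) ^ (1 / p)

namespace WMix

open ProbabilityTheory Filter Topology

variable {X Ω : Type*} [MeasurableSpace X] [MeasurableSpace Ω]

noncomputable def mA (h : X × X → ℝ≥0∞) (ν : Measure X) (x : X) : ℝ≥0∞ := ∫⁻ y, h (x, y) ∂ν
noncomputable def mB (h : X × X → ℝ≥0∞) (μ : Measure X) (y : X) : ℝ≥0∞ := ∫⁻ x, h (x, y) ∂μ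
noncomputable def clip (h : X × X → ℝ≥0∞) (μ ν : Measure X) (z : X × X) : ℝ≥0∞ :=
  h z * (max 1 (max (mA h ν z.1) (mB h μ z.2)))⁻¹
noncomputable def compl (g : X × X → ℝ≥0∞) (μ ν : Measure X) (z : X × X) : ℝ≥0∞ :=
  g z + (1 - mA g ν z.1) * (1 - mB g μ z.2) * (∫⁻ x, (1 - mA g ν x) ∂μ)⁻¹

lemma meas_mA {h : X × X → ℝ≥0∞} (hh : Measurable h) (ν : Measure X) [SFinite ν] :
    Measurable (mA h ν) := hh.lintegral_prod_right'
lemma meas_mB {h : X × X → ℝ≥0∞} (hh : Measurable h) (μ : Measure X) [SFinite μ] :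
    Measurable (mB h μ) := hh.lintegral_prod_left'
lemma meas_clip {h : X × X → ℝ≥0∞} (hh : Measurable h) (μ ν : Measure X) [SFinite μ] [SFinite ν] :
    Measurable (clip h μ ν) := by
  have := meas_mA hh ν
  have := meas_mB hh μ
  unfold clip; fun_prop
lemma meas_compl {h : X × X → ℝ≥0∞} (hh : Measurable h) (μ ν : Measure X) [SFinite μ] [SFinite ν] :
    Measurable (compl h μ ν) := by
  have := meas_mA hh ν
  have := meas_mB hh μ
  unfold compl; fun_prop

lemma mA_clip_le {h : X × X → ℝ≥0∞} (hh : Measurable h) (μ ν : Measure X) (x : X) :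
    mA (clip h μ ν) ν x ≤ 1 := by
  calc mA (clip h μ ν) ν x ≤ ∫⁻ y, h (x, y) * (max 1 (mA h ν x))⁻¹ ∂ν := by
        apply lintegral_mono; intro y
        simp only [clip]
        gcongr
        exact le_max_left _ _
    _ = mA h ν x * (max 1 (mA h ν x))⁻¹ := by
        rw [lintegral_mul_const _ (by fun_prop)]; rfl
    _ ≤ 1 := by
        rw [← div_eq_mul_inv]
        apply ENNReal.div_le_of_le_mul
        simp

lemma mB_clip_le {h : X × X → ℝ≥0∞} (hh : Measurable h) (μ ν : Measure X) (x : X) :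
    mB (clip h μ ν) μ x ≤ 1 := by
  calc mB (clip h μ ν) μ x ≤ ∫⁻ y, h (y, x) * (max 1 (mB h μ x))⁻¹ ∂μ := by
        apply lintegral_mono; intro y
        simp only [clip]
        gcongr
        exact le_max_right _ _
    _ = mB h μ x * (max 1 (mB h μ x))⁻¹ := by
        rw [lintegral_mul_const _ (by fun_prop)]; rfl
    _ ≤ 1 := by
        rw [← div_eq_mul_inv]
        apply ENNReal.div_le_of_le_mul
        simp

lemma clip_eq {h : X × X → ℝ≥0∞} {μ ν : Measure X} (hA : ∀ x, mA h ν x ≤ 1)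
    (hB : ∀ x, mB h μ x ≤ 1) : clip h μ ν = h := by
  ext z
  simp [clip, hA, hB]

lemma marg_fst {D : X × X → ℝ≥0∞} (hD : Measurable D) (μ ν : Measure X) [SFinite μ] [SFinite ν]
    (h1 : ∀ᵐ x ∂μ, mA D ν x = 1) : ((μ.prod ν).withDensity D).map Prod.fst = μ := by
  ext s hs
  rw [Measure.map_apply measurable_fst hs, withDensity_apply _ (measurable_fst hs),
    ← lintegral_indicator (measurable_fst hs), lintegral_prod _ (by
      exact (hD.indicator (measurable_fst hs)).aemeasurable), ← lintegral_indicator_one hs]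
  apply lintegral_congr_ae
  filter_upwards [h1] with x hx
  by_cases hxs : x ∈ s
  · simpa [Set.indicator, hxs, mA, mB] using hx
  · simp [Set.indicator, hxs]

lemma marg_snd {D : X × X → ℝ≥0∞} (hD : Measurable D) (μ ν : Measure X) [SFinite μ] [SFinite ν]
    (h1 : ∀ᵐ x ∂ν, mB D μ x = 1) : ((μ.prod ν).withDensity D).map Prod.snd = ν := by
  ext s hs
  rw [Measure.map_apply measurable_snd hs, withDensity_apply _ (measurable_snd hs),
    ← lintegral_indicator (measurable_snd hs), lintegral_prod_symm _ (by
      exact (hD.indicator (measurable_snd hs)).aemeasurable), ← lintegral_indicator_one hs]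
  apply lintegral_congr_ae
  filter_upwards [h1] with x hx
  by_cases hxs : x ∈ s
  · simpa [Set.indicator, hxs, mA, mB] using hx
  · simp [Set.indicator, hxs]

lemma mass_eq {g : X × X → ℝ≥0∞} (hg : Measurable g) (μ ν : Measure X)
    [IsProbabilityMeasure μ] [IsProbabilityMeasure ν]
    (hA : ∀ x, mA g ν x ≤ 1) (hB : ∀ x, mB g μ x ≤ 1) :
    ∫⁻ x, (1 - mA g ν x) ∂μ = ∫⁻ y, (1 - mB g μ y) ∂ν := by
  have e1 : ∫⁻ x, mA g ν x ∂μ = ∫⁻ y, mB g μ y ∂ν := by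
    unfold mA mB
    rw [← lintegral_prod _ hg.aemeasurable, ← lintegral_prod_symm _ hg.aemeasurable]
  have f1 : ∫⁻ x, mA g ν x ∂μ ≠ ∞ := by
    refine ne_top_of_le_ne_top one_ne_top ((lintegral_mono hA).trans ?_)
    simp
  rw [lintegral_sub (meas_mA hg ν) f1 (ae_of_all _ hA),
    lintegral_sub (meas_mB hg μ) (e1 ▸ f1) (ae_of_all _ hB), e1]
  simp

lemma mA_compl {g : X × X → ℝ≥0∞} (hg : Measurable g) (μ ν : Measure X)
    [IsProbabilityMeasure μ] [IsProbabilityMeasure ν]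
    (hA : ∀ x, mA g ν x ≤ 1) (hB : ∀ x, mB g μ x ≤ 1) :
    ∀ᵐ x ∂μ, mA (compl g μ ν) ν x = 1 := by
  have hm := mass_eq hg μ ν hA hB
  have key : ∀ x, mA (compl g μ ν) ν x = mA g ν x + (1 - mA g ν x) *
      ((∫⁻ x, (1 - mA g ν x) ∂μ) * (∫⁻ x, (1 - mA g ν x) ∂μ)⁻¹) := by
    intro x
    have := meas_mB hg μ
    have := meas_mA hg ν
    conv_lhs => unfold mA compl
    dsimp only
    rw [lintegral_add_left (by fun_prop), lintegral_mul_const _ (by fun_prop),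
      lintegral_const_mul _ (by fun_prop), ← hm, mul_assoc]
    rfl
  by_cases h0 : ∫⁻ x, (1 - mA g ν x) ∂μ = 0
  · have h0' := h0
    rw [lintegral_eq_zero_iff (by have := meas_mA hg ν; fun_prop)] at h0
    filter_upwards [h0] with x hx
    rw [key, h0']
    simp [le_antisymm (hA x) (tsub_eq_zero_iff_le.mp hx)]
  · refine ae_of_all _ fun x => ?_
    rw [key, ENNReal.mul_inv_cancel h0, mul_one, add_tsub_cancel_of_le (hA x)]
    refine ne_top_of_le_ne_top one_ne_top ((lintegral_mono (fun x => tsub_le_self)).trans ?_)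
    simp

lemma mB_compl {g : X × X → ℝ≥0∞} (hg : Measurable g) (μ ν : Measure X)
    [IsProbabilityMeasure μ] [IsProbabilityMeasure ν]
    (hA : ∀ x, mA g ν x ≤ 1) (hB : ∀ x, mB g μ x ≤ 1) :
    ∀ᵐ x ∂ν, mB (compl g μ ν) μ x = 1 := by
  have hm := mass_eq hg μ ν hA hB
  have key : ∀ x, mB (compl g μ ν) μ x = mB g μ x + (1 - mB g μ x) *
      ((∫⁻ x, (1 - mA g ν x) ∂μ) * (∫⁻ x, (1 - mA g ν x) ∂μ)⁻¹) := by
    intro x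
    have := meas_mA hg ν
    have := meas_mB hg μ
    conv_lhs => unfold mB compl
    dsimp only
    rw [lintegral_add_left (by fun_prop), lintegral_mul_const _ (by fun_prop),
      lintegral_mul_const _ (by fun_prop), mul_comm (lintegral _ _) (1 - _), mul_assoc]
    rfl
  by_cases h0 : ∫⁻ x, (1 - mA g ν x) ∂μ = 0
  · have h0' := h0
    rw [hm, lintegral_eq_zero_iff (by have := meas_mB hg μ; fun_prop)] at h0
    filter_upwards [h0] with x hx
    rw [key, h0']
    simp [le_antisymm (hB x) (tsub_eq_zero_iff_le.mp hx)]
  · refine ae_of_all _ fun x => ?_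
    rw [key, ENNReal.mul_inv_cancel h0, mul_one, add_tsub_cancel_of_le (hB x)]
    refine ne_top_of_le_ne_top one_ne_top ((lintegral_mono (fun x => tsub_le_self)).trans ?_)
    simp

/-- cost estimate -/
lemma cost_compl {g : X × X → ℝ≥0∞} (hg : Measurable g) (μ ν : Measure X)
    [IsProbabilityMeasure μ] [IsProbabilityMeasure ν]
    (hA : ∀ x, mA g ν x ≤ 1) (hB : ∀ x, mB g μ x ≤ 1) (c : X × X → ℝ≥0∞) (hc : Measurable c)
    (u : X → ℝ≥0∞) (hu : Measurable u) (hcu : ∀ z, c z ≤ u z.1 + u z.2) :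
    ∫⁻ z, compl g μ ν z * c z ∂(μ.prod ν) ≤ ∫⁻ z, g z * c z ∂(μ.prod ν)
      + (∫⁻ x, (1 - mA g ν x) * u x ∂μ + ∫⁻ x, (1 - mB g μ x) * u x ∂ν) := by
  have hm := mass_eq hg μ ν hA hB
  have m1 := meas_mA hg ν
  have m2 := meas_mB hg μ
  unfold compl
  simp_rw [add_mul]
  rw [lintegral_add_left (by fun_prop)]
  gcongr
  set m := ∫⁻ x, (1 - mA g ν x) ∂μ with hmdef
  calc _ ≤ ∫⁻ z, (((1 - mA g ν z.1) * u z.1) * (1 - mB g μ z.2)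
            + (1 - mA g ν z.1) * ((1 - mB g μ z.2) * u z.2)) * m⁻¹ ∂(μ.prod ν) := by
        apply lintegral_mono; intro z
        calc _ ≤ (1 - mA g ν z.1) * (1 - mB g μ z.2) * m⁻¹ * (u z.1 + u z.2) := by
              exact mul_le_mul_right (hcu z) _
          _ = _ := by ring
    _ = ((∫⁻ x, (1 - mA g ν x) * u x ∂μ) * m + m * ∫⁻ x, (1 - mB g μ x) * u x ∂ν) * m⁻¹ := by
        rw [lintegral_mul_const _ (by fun_prop), lintegral_add_left (by fun_prop),
          lintegral_prod_mul (f := fun x => (1 - mA g ν x) * u x) (g := fun y => 1 - mB g μ y) (by fun_prop) (by fun_prop), lintegral_prod_mul (f := fun x => (1 - mA g ν x)) (g := fun y => (1 - mB g μ y) * u y) (by fun_prop) (by fun_prop), ← hm]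
    _ = (∫⁻ x, (1 - mA g ν x) * u x ∂μ + ∫⁻ x, (1 - mB g μ x) * u x ∂ν) * (m * m⁻¹) := by ring
    _ ≤ _ := by
        apply mul_le_of_le_one_right' 
        exact ENNReal.mul_inv_le_one m

section joint
variable (κ η : Kernel Ω X) [IsMarkovKernel κ] [IsMarkovKernel η]

lemma jA {f : Ω × (X × X) → ℝ≥0∞} (hf : Measurable f) :
    Measurable fun q : Ω × X => mA (fun z => f (q.1, z)) (η q.1) q.2 := by
  exact Measurable.lintegral_kernel_prod_right' (κ := Kernel.comap η Prod.fst measurable_fst)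
    (f := fun q : (Ω × X) × X => f (q.1.1, (q.1.2, q.2))) (by fun_prop)

lemma jB {f : Ω × (X × X) → ℝ≥0∞} (hf : Measurable f) :
    Measurable fun q : Ω × X => mB (fun z => f (q.1, z)) (κ q.1) q.2 := by
  exact Measurable.lintegral_kernel_prod_right' (κ := Kernel.comap κ Prod.fst measurable_fst)
    (f := fun q : (Ω × X) × X => f (q.1.1, (q.2, q.1.2))) (by fun_prop)

lemma jclip {h : X × X → ℝ≥0∞} (hh : Measurable h) :
    Measurable fun q : Ω × (X × X) => clip h (κ q.1) (η q.1) q.2 := by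
  have a := (jA η (f := fun q => h q.2) (by fun_prop)).comp
    (f := fun q : Ω × (X × X) => (q.1, q.2.1)) (by fun_prop)
  have b := (jB κ (f := fun q => h q.2) (by fun_prop)).comp
    (f := fun q : Ω × (X × X) => (q.1, q.2.2)) (by fun_prop)
  simp only [Function.comp_def] at a b
  unfold clip
  fun_prop

lemma jcompl {f : Ω × (X × X) → ℝ≥0∞} (hf : Measurable f) :
    Measurable fun q : Ω × (X × X) => compl (fun z => f (q.1, z)) (κ q.1) (η q.1) q.2 := by
  have a0 := jA η hf
  have a := (jA η hf).comp
    (f := fun q : Ω × (X × X) => (q.1, q.2.1)) (by fun_prop)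
  have b := (jB κ hf).comp
    (f := fun q : Ω × (X × X) => (q.1, q.2.2)) (by fun_prop)
  have c : Measurable fun q : Ω => ∫⁻ x, (1 - mA (fun z => f (q, z)) (η q) x) ∂(κ q) :=
    Measurable.lintegral_kernel_prod_right' (κ := κ)
      (f := fun q : Ω × X => 1 - mA (fun z => f (q.1, z)) (η q.1) q.2) (by fun_prop)
  have c' := c.comp (measurable_fst : Measurable (fun q : Ω × (X × X) => q.1))
  simp only [Function.comp_def] at a b c'
  unfold compl
  fun_prop

/-- the density -/
noncomputable def dens (h : X × X → ℝ≥0∞) (μ ν : Measure X) : X × X → ℝ≥0∞ :=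
  compl (clip h μ ν) μ ν

lemma exists_kernel {h : X × X → ℝ≥0∞} (hh : Measurable h) :
    ∃ K : Kernel Ω (X × X), ∀ c, K c = ((κ c).prod (η c)).withDensity (dens h (κ c) (η c)) := by
  refine ⟨Kernel.withDensity (κ ×ₖ η) (fun c => dens h (κ c) (η c)), fun c => ?_⟩
  rw [Kernel.withDensity_apply, Kernel.prod_apply]
  exact jcompl κ η (f := fun q => clip h (κ q.1) (η q.1) q.2) (jclip κ η hh)
end joint

lemma dens_coupling {h : X × X → ℝ≥0∞} (hh : Measurable h) (μ ν : Measure X)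
    [IsProbabilityMeasure μ] [IsProbabilityMeasure ν] :
    ((μ.prod ν).withDensity (dens h μ ν)).map Prod.fst = μ ∧
    ((μ.prod ν).withDensity (dens h μ ν)).map Prod.snd = ν := by
  have hg := meas_clip hh μ ν
  have hA := mA_clip_le hh μ ν
  have hB := mB_clip_le hh μ ν
  exact ⟨marg_fst (meas_compl hg _ _) _ _ (mA_compl hg μ ν hA hB),
    marg_snd (meas_compl hg _ _) _ _ (mB_compl hg μ ν hA hB)⟩

noncomputable def hst (M N : Measure ℕ) (P : Measure (ℕ × ℕ)) (z : ℕ × ℕ) : ℝ≥0∞ :=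
  P {z} * ((M {z.1})⁻¹ * (N {z.2})⁻¹)

section disc
set_option linter.unusedSectionVars false
variable {M N : Measure ℕ} {P : Measure (ℕ × ℕ)} [IsProbabilityMeasure M] [IsProbabilityMeasure N]
  (h1 : P.map Prod.fst = M) (h2 : P.map Prod.snd = N)
include h1 h2

lemma P_zero_fst (z : ℕ × ℕ) (hz : M {z.1} = 0) : P {z} = 0 := by
  rw [← h1, Measure.map_apply measurable_fst (measurableSet_singleton _)] at hz
  exact measure_mono_null (by intro w hw; simp_all) hz
lemma P_zero_snd (z : ℕ × ℕ) (hz : N {z.2} = 0) : P {z} = 0 := by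
  rw [← h2, Measure.map_apply measurable_snd (measurableSet_singleton _)] at hz
  exact measure_mono_null (by intro w hw; simp_all) hz

lemma hst_mul (z : ℕ × ℕ) : hst M N P z * (M {z.1} * N {z.2}) = P {z} := by
  by_cases a : M {z.1} = 0
  · simp [hst, P_zero_fst h1 h2 z a]
  by_cases b : N {z.2} = 0
  · simp [hst, P_zero_snd h1 h2 z b]
  unfold hst
  calc _ = P {z} * ((M {z.1} * (M {z.1})⁻¹) * (N {z.2} * (N {z.2})⁻¹)) := by ring
    _ = _ := by
      rw [ENNReal.mul_inv_cancel a (measure_ne_top _ _), ENNReal.mul_inv_cancel b (measure_ne_top _ _)]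
      simp

lemma hst_ne_top (z : ℕ × ℕ) : hst M N P z ≠ ∞ := by
  have hP : IsProbabilityMeasure P := by
    constructor
    have : (P.map Prod.fst) Set.univ = 1 := by rw [h1]; simp
    rwa [Measure.map_apply measurable_fst MeasurableSet.univ, Set.preimage_univ] at this
  by_cases a : M {z.1} = 0
  · simp [hst, P_zero_fst h1 h2 z a]
  by_cases b : N {z.2} = 0
  · simp [hst, P_zero_snd h1 h2 z b]
  unfold hst
  have := measure_ne_top P {z}
  finiteness

lemma hst_mA (i : ℕ) : mA (hst M N P) N i ≤ 1 := by
  unfold mA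
  rw [lintegral_countable']
  calc _ ≤ ∑' j, P {(i, j)} * (M {i})⁻¹ := by
        refine ENNReal.tsum_le_tsum fun j => ?_
        unfold hst
        calc _ = P {(i,j)} * (M {i})⁻¹ * (N {j} * (N {j})⁻¹) := by ring
          _ ≤ _ := mul_le_of_le_one_right' (ENNReal.mul_inv_le_one _)
    _ = M {i} * (M {i})⁻¹ := by
        rw [ENNReal.tsum_mul_right, ← h1, Measure.map_apply measurable_fst (measurableSet_singleton _)]
        congr 1
        rw [← measure_iUnion]
        · congr 1; ext ⟨a, b⟩; simp [eq_comm]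
        · intro a b hab; simp [hab]
        · intro j; exact measurableSet_singleton _
    _ ≤ 1 := ENNReal.mul_inv_le_one _

lemma hst_mB (i : ℕ) : mB (hst M N P) M i ≤ 1 := by
  unfold mB
  rw [lintegral_countable']
  calc _ ≤ ∑' j, P {(j, i)} * (N {i})⁻¹ := by
        refine ENNReal.tsum_le_tsum fun j => ?_
        unfold hst
        calc _ = P {(j,i)} * (N {i})⁻¹ * (M {j} * (M {j})⁻¹) := by ring
          _ ≤ _ := mul_le_of_le_one_right' (ENNReal.mul_inv_le_one _)
    _ = N {i} * (N {i})⁻¹ := by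
        rw [ENNReal.tsum_mul_right, ← h2, Measure.map_apply measurable_snd (measurableSet_singleton _)]
        congr 1
        rw [← measure_iUnion]
        · congr 1; ext ⟨a, b⟩; simp [eq_comm]
        · intro a b hab; simp [hab]
        · intro j; exact measurableSet_singleton _
    _ ≤ 1 := ENNReal.mul_inv_le_one _

lemma hst_int (H : ℕ × ℕ → ℝ≥0∞) :
    ∫⁻ z, hst M N P z * H z ∂(M.prod N) = ∫⁻ z, H z ∂P := by
  rw [lintegral_countable', lintegral_countable']
  congr 1; ext z
  rw [← hst_mul h1 h2 z, ← Prod.mk.eta (p := z), ← Set.singleton_prod_singleton, Measure.prod_prod]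
  ring
end disc

/-- transferred version -/
lemma disc {φ : X → ℕ} (hφ : Measurable φ) {μ ν : Measure X} {π : Measure (X × X)}
    [IsProbabilityMeasure μ] [IsProbabilityMeasure ν]
    (h1 : π.map Prod.fst = μ) (h2 : π.map Prod.snd = ν) :
    ∃ f : ℕ × ℕ → ℝ≥0∞, (∀ z, f z ≠ ∞) ∧
      (∀ x, mA (fun z => f (φ z.1, φ z.2)) ν x ≤ 1) ∧
      (∀ x, mB (fun z => f (φ z.1, φ z.2)) μ x ≤ 1) ∧
      (∀ᵐ x ∂μ, mA (fun z => f (φ z.1, φ z.2)) ν x = 1) ∧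
      (∀ᵐ x ∂ν, mB (fun z => f (φ z.1, φ z.2)) μ x = 1) ∧
      ∀ H : ℕ × ℕ → ℝ≥0∞, ∫⁻ z, f (φ z.1, φ z.2) * H (φ z.1, φ z.2) ∂(μ.prod ν) =
        ∫⁻ z, H (φ z.1, φ z.2) ∂π := by
  have hφ2 : Measurable (Prod.map φ φ) := by fun_prop
  have hM : IsProbabilityMeasure (μ.map φ) := Measure.isProbabilityMeasure_map hφ.aemeasurable
  have hN : IsProbabilityMeasure (ν.map φ) := Measure.isProbabilityMeasure_map hφ.aemeasurable
  have k1 : (π.map (Prod.map φ φ)).map Prod.fst = μ.map φ := by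
    rw [Measure.map_map measurable_fst hφ2, ← h1, Measure.map_map hφ measurable_fst]; rfl
  have k2 : (π.map (Prod.map φ φ)).map Prod.snd = ν.map φ := by
    rw [Measure.map_map measurable_snd hφ2, ← h2, Measure.map_map hφ measurable_snd]; rfl
  have hπ : π Set.univ = 1 := by
    have : (π.map Prod.fst) Set.univ = 1 := by rw [h1]; simp
    rwa [Measure.map_apply measurable_fst MeasurableSet.univ, Set.preimage_univ] at this
  set f := hst (μ.map φ) (ν.map φ) (π.map (Prod.map φ φ)) with hf
  have mf : Measurable f := measurable_of_countable f
  have mff : Measurable (fun z : X × X => f (φ z.1, φ z.2)) := by fun_prop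
  have eA : ∀ x, mA (fun z => f (φ z.1, φ z.2)) ν x = mA f (ν.map φ) (φ x) := by
    intro x
    unfold mA
    rw [lintegral_map (by fun_prop) hφ]
  have eB : ∀ x, mB (fun z => f (φ z.1, φ z.2)) μ x = mB f (μ.map φ) (φ x) := by
    intro x
    unfold mB
    rw [lintegral_map (by fun_prop) hφ]
  have cA : ∀ x, mA (fun z => f (φ z.1, φ z.2)) ν x ≤ 1 := by
    intro x; rw [eA]; exact hst_mA k1 k2 _
  have cB : ∀ x, mB (fun z => f (φ z.1, φ z.2)) μ x ≤ 1 := by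
    intro x; rw [eB]; exact hst_mB k1 k2 _
  have hH : ∀ H : ℕ × ℕ → ℝ≥0∞, ∫⁻ z, f (φ z.1, φ z.2) * H (φ z.1, φ z.2) ∂(μ.prod ν) =
        ∫⁻ z, H (φ z.1, φ z.2) ∂π := by
    intro H
    have := hst_int k1 k2 H
    rw [Measure.map_prod_map _ _ hφ hφ, lintegral_map (measurable_of_countable _) hφ2,
      lintegral_map (measurable_of_countable _) hφ2] at this
    exact this
  have tot : ∫⁻ z, f (φ z.1, φ z.2) ∂(μ.prod ν) = 1 := by
    have := hH (fun _ => 1)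
    simpa [hπ] using this
  have aux : ∀ (τ : Measure X) [IsProbabilityMeasure τ] (a : X → ℝ≥0∞), Measurable a →
      (∀ x, a x ≤ 1) → ∫⁻ x, a x ∂τ = 1 → ∀ᵐ x ∂τ, a x = 1 := by
    intro τ _ a ma ha hi
    have h0 : ∫⁻ x, (1 - a x) ∂τ = 0 := by
      rw [lintegral_sub ma (by simp [hi]) (ae_of_all _ ha), hi]; simp
    rw [lintegral_eq_zero_iff (by fun_prop)] at h0
    filter_upwards [h0] with x hx
    exact le_antisymm (ha x) (tsub_eq_zero_iff_le.mp hx)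
  refine ⟨f, fun z => hst_ne_top k1 k2 z, cA, cB, ?_, ?_, hH⟩
  · refine aux _ _ (meas_mA mff ν) cA ?_
    unfold mA
    rw [← lintegral_prod _ mff.aemeasurable, tot]
  · refine aux _ _ (meas_mB mff μ) cB ?_
    unfold mB
    rw [← lintegral_prod_symm _ mff.aemeasurable, tot]

noncomputable def rf (k : ℕ) (r : ℕ × ℕ →₀ ℕ) (z : ℕ × ℕ) : ℝ≥0∞ := ENNReal.ofReal ((r z : ℝ) / k)

lemma approx_seq (f : ℕ × ℕ → ℝ≥0∞) (hf : ∀ z, f z ≠ ∞) :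
    ∃ r : ℕ → (ℕ × ℕ →₀ ℕ), (∀ k z, rf k (r k) z ≤ f z) ∧
      ∀ z, Tendsto (fun k => rf k (r k) z) atTop (𝓝 (f z)) := by
  classical
  refine ⟨fun k => Finsupp.onFinset (Finset.range k ×ˢ Finset.range k)
    (fun z => if z ∈ Finset.range k ×ˢ Finset.range k then ⌊(f z).toReal * k⌋₊ else 0)
    (by intro a ha; by_contra h; simp [h] at ha), ?_, ?_⟩
  · intro k z
    unfold rf
    rw [Finsupp.onFinset_apply]
    split_ifs with h
    · apply ENNReal.ofReal_le_of_le_toReal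
      have hk : (0 : ℝ) < k := by
        simp at h; exact_mod_cast lt_of_le_of_lt (Nat.zero_le _) h.1
      rw [div_le_iff₀ hk]
      exact Nat.floor_le (by positivity)
    · simp
  · intro z
    have := (tendsto_nat_floor_mul_div_atTop (R := ℝ) (a := (f z).toReal) toReal_nonneg).comp
      (tendsto_natCast_atTop_atTop (R := ℝ))
    have := ENNReal.tendsto_ofReal this
    rw [ENNReal.ofReal_toReal (hf z)] at this
    refine this.congr' ?_
    filter_upwards [eventually_gt_atTop (max z.1 z.2)] with k hk
    have : z ∈ Finset.range k ×ˢ Finset.range k := by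
      simp at hk ⊢; exact hk
    unfold rf
    rw [Finsupp.onFinset_apply, if_pos this]
    rfl

/-- the candidate functions -/
noncomputable def cand (φ : X → ℕ) (k : ℕ) (r : ℕ × ℕ →₀ ℕ) (z : X × X) : ℝ≥0∞ :=
  rf k r (φ z.1, φ z.2)

lemma meas_cand {φ : X → ℕ} (hφ : Measurable φ) (k r) : Measurable (cand φ k r) := by
  have : Measurable (rf k r) := measurable_of_countable _
  unfold cand; fun_prop

lemma approx1 {φ : X → ℕ} (hφ : Measurable φ) {μ ν : Measure X} {π : Measure (X × X)}
    [IsProbabilityMeasure μ] [IsProbabilityMeasure ν]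
    (h1 : π.map Prod.fst = μ) (h2 : π.map Prod.snd = ν)
    (c : X × X → ℝ≥0∞) (hc : Measurable c)
    (u : X → ℝ≥0∞) (hu : Measurable u) (hcu : ∀ z, c z ≤ u z.1 + u z.2)
    (huμ : ∫⁻ x, u x ∂μ ≠ ∞) (huν : ∫⁻ x, u x ∂ν ≠ ∞)
    (H : ℕ × ℕ → ℝ≥0∞) (hH : ∀ z, c z ≤ H (φ z.1, φ z.2)) (ε : ℝ≥0∞) (hε : 0 < ε) :
    ∃ k r, ∫⁻ z, c z ∂((μ.prod ν).withDensity (dens (cand φ k r) μ ν)) ≤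
      ∫⁻ z, H (φ z.1, φ z.2) ∂π + ε := by
  obtain ⟨f, ft, fA, fB, fA1, fB1, fH⟩ := disc hφ h1 h2
  obtain ⟨r, hr, hrt⟩ := approx_seq f ft
  have mf : Measurable f := measurable_of_countable f
  have mff : Measurable (fun z : X × X => f (φ z.1, φ z.2)) := by fun_prop
  have mc := fun k => meas_cand hφ k (r k)
  have cle : ∀ k z, cand φ k (r k) z ≤ f (φ z.1, φ z.2) := fun k z => hr k _
  have gA : ∀ k x, mA (cand φ k (r k)) ν x ≤ 1 := fun k x =>
    (lintegral_mono fun y => cle k _).trans (fA x)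
  have gB : ∀ k x, mB (cand φ k (r k)) μ x ≤ 1 := fun k x =>
    (lintegral_mono fun y => cle k _).trans (fB x)
  have tA : ∀ x, mA (fun z => f (φ z.1, φ z.2)) ν x = 1 →
      Tendsto (fun k => mA (cand φ k (r k)) ν x) atTop (𝓝 1) := by
    intro x hx
    rw [← hx]
    refine tendsto_lintegral_of_dominated_convergence (fun y => f (φ x, φ y))
      (fun k => by have := mc k; fun_prop) (fun k => ae_of_all _ fun y => cle k _) ?_
      (ae_of_all _ fun y => hrt _)
    exact ne_top_of_le_ne_top one_ne_top (fA x)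
  have tB : ∀ x, mB (fun z => f (φ z.1, φ z.2)) μ x = 1 →
      Tendsto (fun k => mB (cand φ k (r k)) μ x) atTop (𝓝 1) := by
    intro x hx
    rw [← hx]
    refine tendsto_lintegral_of_dominated_convergence (fun y => f (φ y, φ x))
      (fun k => by have := mc k; fun_prop) (fun k => ae_of_all _ fun y => cle k _) ?_
      (ae_of_all _ fun y => hrt _)
    exact ne_top_of_le_ne_top one_ne_top (fB x)
  have aux : ∀ (τ : Measure X) (a : ℕ → X → ℝ≥0∞), (∀ k, Measurable (a k)) →
      ∫⁻ x, u x ∂τ ≠ ∞ → (∀ᵐ x ∂τ, Tendsto (fun k => a k x) atTop (𝓝 1)) →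
      Tendsto (fun k => ∫⁻ x, (1 - a k x) * u x ∂τ) atTop (𝓝 0) := by
    intro τ a ma hu' hta
    have : Tendsto (fun k => ∫⁻ x, (1 - a k x) * u x ∂τ) atTop (𝓝 (∫⁻ x, 0 ∂τ)) := by
      refine tendsto_lintegral_of_dominated_convergence u
        (fun k => by have := ma k; fun_prop)
        (fun k => ae_of_all _ fun y => mul_le_of_le_one_left' tsub_le_self) hu' ?_
      filter_upwards [hta, ae_lt_top hu hu'] with x hx hux
      have t1 : Tendsto (fun k => 1 - a k x) atTop (𝓝 (1 - 1)) :=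
        ENNReal.Tendsto.sub tendsto_const_nhds hx (Or.inl one_ne_top)
      have t2 := ENNReal.Tendsto.mul_const t1 (b := u x) (Or.inr hux.ne)
      simpa using t2
    simpa using this
  have T := (aux μ _ (fun k => meas_mA (mc k) ν) huμ (fA1.mono tA)).add
    (aux ν _ (fun k => meas_mB (mc k) μ) huν (fB1.mono tB))
  rw [add_zero] at T
  obtain ⟨k, hk⟩ := (T.eventually (ge_mem_nhds hε)).exists
  refine ⟨k, r k, ?_⟩
  have hg := mc k
  rw [lintegral_withDensity_eq_lintegral_mul _ (by
    unfold dens; exact meas_compl (meas_clip hg _ _) _ _) hc]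
  unfold dens
  rw [clip_eq (gA k) (gB k)]
  refine (cost_compl hg μ ν (gA k) (gB k) c hc u hu hcu).trans (add_le_add ?_ hk)
  rw [← fH H]
  exact lintegral_mono fun z => mul_le_mul' (cle k z) (hH z)

end WMix

namespace WMix
open ProbabilityTheory Filter Topology

section metric
variable {X Ω : Type*} [MeasurableSpace Ω] [MetricSpace X] [MeasurableSpace X] [BorelSpace X]
  [PolishSpace X]

lemma exists_part [Nonempty X] (n : ℕ) : ∃ φ : X → ℕ, Measurable φ ∧
    ∀ x y, φ x = φ y → edist x y ≤ 2 * ((n : ℝ≥0∞) + 1)⁻¹ := by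
  classical
  have hex : ∀ x : X, ∃ i, edist x (TopologicalSpace.denseSeq X i) < ((n : ℝ≥0∞) + 1)⁻¹ := by
    intro x
    have hpos : (0 : ℝ≥0∞) < ((n : ℝ≥0∞) + 1)⁻¹ := by
      rw [ENNReal.inv_pos]; finiteness
    have := (TopologicalSpace.denseRange_denseSeq X).exists_mem_open
      (Metric.isOpen_eball (x := x) (ε := ((n : ℝ≥0∞) + 1)⁻¹)) ⟨x, Metric.mem_eball_self hpos⟩
    obtain ⟨i, hi⟩ := this
    exact ⟨i, by rw [edist_comm]; exact hi⟩
  refine ⟨fun x => Nat.find (hex x), measurable_find hex fun k => ?_, fun x y h => ?_⟩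
  · exact measurableSet_lt (by fun_prop) measurable_const
  · have hx := (Nat.find_spec (hex x)).le
    have hy := (Nat.find_spec (hex y)).le
    dsimp only at h
    rw [← h, edist_comm] at hy
    calc _ ≤ _ := edist_triangle _ _ _
      _ ≤ _ := add_le_add hx hy
      _ = _ := by ring

lemma approx2 (p : ℝ) (hp : 1 ≤ p) (x₀ : X) (φ : ℕ → X → ℕ) (hφ : ∀ n, Measurable (φ n))
    (hφd : ∀ n x y, φ n x = φ n y → edist x y ≤ 2 * ((n : ℝ≥0∞) + 1)⁻¹)
    {μ ν : Measure X} {π : Measure (X × X)}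
    [IsProbabilityMeasure μ] [IsProbabilityMeasure ν]
    (h1 : π.map Prod.fst = μ) (h2 : π.map Prod.snd = ν)
    (hmμ : ∫⁻ x, edist x x₀ ^ p ∂μ ≠ ∞) (hmν : ∫⁻ x, edist x x₀ ^ p ∂ν ≠ ∞)
    (ε : ℝ≥0∞) (hε : 0 < ε) :
    ∃ n k r, ∫⁻ z, edist z.1 z.2 ^ p ∂((μ.prod ν).withDensity (dens (cand (φ n) k r) μ ν)) ≤
      ∫⁻ z, edist z.1 z.2 ^ p ∂π + ε := by
  have p0 : 0 ≤ p := by linarith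
  have hC : (2 : ℝ≥0∞) ^ (p - 1) ≠ ∞ := ENNReal.rpow_ne_top_of_nonneg (by linarith) (by simp)
  have hπ : π Set.univ = 1 := by
    have : (π.map Prod.fst) Set.univ = 1 := by rw [h1]; simp
    rwa [Measure.map_apply measurable_fst MeasurableSet.univ, Set.preimage_univ] at this
  have mc : Measurable (fun z : X × X => edist z.1 z.2 ^ p) := by fun_prop
  set u : X → ℝ≥0∞ := fun x => 2 ^ (p - 1) * edist x x₀ ^ p with hu
  have mu : Measurable u := by fun_prop
  have huμ : ∫⁻ x, u x ∂μ ≠ ∞ := by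
    rw [lintegral_const_mul _ (by fun_prop)]; exact ENNReal.mul_ne_top hC hmμ
  have huν : ∫⁻ x, u x ∂ν ≠ ∞ := by
    rw [lintegral_const_mul _ (by fun_prop)]; exact ENNReal.mul_ne_top hC hmν
  have hcu : ∀ z : X × X, edist z.1 z.2 ^ p ≤ u z.1 + u z.2 := by
    intro z
    calc _ ≤ (edist z.1 x₀ + edist z.2 x₀) ^ p :=
          ENNReal.rpow_le_rpow (edist_triangle_right _ _ _) p0
      _ ≤ _ := ENNReal.rpow_add_le_mul_rpow_add_rpow _ _ hp
      _ = _ := by simp only [hu]; ring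
  by_cases htop : ∫⁻ z, edist z.1 z.2 ^ p ∂π = ∞
  · exact ⟨0, 0, 0, by simp [htop]⟩
  have T : Tendsto (fun n : ℕ => ∫⁻ z, (edist z.1 z.2 + 4 * ((n : ℝ≥0∞) + 1)⁻¹) ^ p ∂π) atTop
      (𝓝 (∫⁻ z, edist z.1 z.2 ^ p ∂π)) := by
    refine tendsto_lintegral_of_dominated_convergence
      (fun z => 2 ^ (p - 1) * (edist z.1 z.2 ^ p + 4 ^ p)) (fun n => by fun_prop)
      (fun n => ae_of_all _ fun z => ?_) ?_ (ae_of_all _ fun z => ?_)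
    · refine le_trans ?_ (ENNReal.rpow_add_le_mul_rpow_add_rpow _ _ hp)
      refine ENNReal.rpow_le_rpow ?_ p0
      gcongr
      apply mul_le_of_le_one_right'
      rw [ENNReal.inv_le_one]
      exact le_add_self
    · rw [lintegral_const_mul _ (by fun_prop), lintegral_add_left (by fun_prop), lintegral_const, hπ]
      have : (4 : ℝ≥0∞) ^ p ≠ ∞ := ENNReal.rpow_ne_top_of_nonneg p0 (by simp)
      finiteness
    · refine ((ENNReal.continuous_rpow_const (y := p)).tendsto _).comp ?_
      have t0 : Tendsto (fun n : ℕ => ((n : ℝ≥0∞) + 1)⁻¹) atTop (𝓝 0) := by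
        have := (tendsto_add_atTop_iff_nat 1).2 ENNReal.tendsto_inv_nat_nhds_zero
        simpa using this
      have t1 := ENNReal.Tendsto.const_mul (a := 4) t0 (Or.inr (by simp))
      have t2 := (tendsto_const_nhds (x := edist z.1 z.2)).add t1
      simpa using t2
  have hlt : ∫⁻ z, edist z.1 z.2 ^ p ∂π < ∫⁻ z, edist z.1 z.2 ^ p ∂π + ε / 2 :=
    ENNReal.lt_add_right htop (ENNReal.half_pos hε.ne').ne'
  obtain ⟨n, hn⟩ := (T.eventually (ge_mem_nhds hlt)).exists
  obtain ⟨k, r, hkr⟩ := approx1 (hφ n) h1 h2 _ mc u mu hcu huμ huν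
    (fun ij => ⨆ z : {z : X × X // φ n z.1 = ij.1 ∧ φ n z.2 = ij.2}, edist z.1.1 z.1.2 ^ p)
    (fun z => le_iSup (fun w : {w : X × X // φ n w.1 = φ n z.1 ∧ φ n w.2 = φ n z.2} =>
      edist w.1.1 w.1.2 ^ p) ⟨z, rfl, rfl⟩) (ε / 2) (ENNReal.half_pos hε.ne')
  refine ⟨n, k, r, hkr.trans ?_⟩
  calc _ ≤ ∫⁻ z, (edist z.1 z.2 + 4 * ((n : ℝ≥0∞) + 1)⁻¹) ^ p ∂π + ε / 2 := by
        gcongr with z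
        refine iSup_le fun w => ENNReal.rpow_le_rpow ?_ p0
        obtain ⟨⟨a, b⟩, ha, hb⟩ := w
        dsimp only at ha hb ⊢
        calc edist a b ≤ edist a z.1 + edist z.1 z.2 + edist z.2 b := edist_triangle4 _ _ _ _
          _ ≤ 2 * ((n : ℝ≥0∞) + 1)⁻¹ + edist z.1 z.2 + 2 * ((n : ℝ≥0∞) + 1)⁻¹ := by
              gcongr
              · exact hφd _ _ _ ha
              · exact hφd _ _ _ hb.symm
          _ = _ := by ring
    _ ≤ ∫⁻ z, edist z.1 z.2 ^ p ∂π + ε / 2 + ε / 2 := by gcongr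
    _ = _ := by rw [add_assoc, ENNReal.add_halves]

noncomputable def ocost (p : ℝ) (μ ν : Measure X) : ℝ≥0∞ :=
  ⨅ π ∈ {π : Measure (X × X) | π.map Prod.fst = μ ∧ π.map Prod.snd = ν},
      ∫⁻ z, edist z.1 z.2 ^ p ∂π

lemma map_bind' {Y : Type*} [MeasurableSpace Y] (ρ : Measure Ω) {K : Ω → Measure (X × X)}
    (hK : Measurable K) {f : X × X → Y} (hf : Measurable f) :
    (ρ.bind K).map f = ρ.bind (fun c => (K c).map f) := by
  have hm : Measurable (fun c => (K c).map f) := (Measure.measurable_map f hf).comp hK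
  ext s hs
  rw [Measure.map_apply hf hs, Measure.bind_apply (hf hs) hK.aemeasurable,
    Measure.bind_apply hs hm.aemeasurable]
  simp_rw [Measure.map_apply hf hs]

lemma ocost_mix (p : ℝ) (hp : 1 ≤ p) (ρ : Measure Ω) [IsProbabilityMeasure ρ]
    (μ ν : Ω → Measure X) (hμ : Measurable μ) (hν : Measurable ν)
    (hμp : ∀ c, IsProbabilityMeasure (μ c)) (hνp : ∀ c, IsProbabilityMeasure (ν c))
    (x₀ : X)
    (hmμ : ∀ c, ∫⁻ x, edist x x₀ ^ p ∂(μ c) ≠ ∞)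
    (hmν : ∀ c, ∫⁻ x, edist x x₀ ^ p ∂(ν c) ≠ ∞) :
    ocost p (ρ.bind μ) (ρ.bind ν) ≤ ∫⁻ c, ocost p (μ c) (ν c) ∂ρ := by
  classical
  have : Nonempty X := ⟨x₀⟩
  have mc : Measurable (fun z : X × X => edist z.1 z.2 ^ p) := by fun_prop
  choose φ hφ hφd using exists_part (X := X)
  obtain ⟨e, he⟩ := exists_surjective_nat (ℕ × ℕ × (ℕ × ℕ →₀ ℕ))
  let κ : Kernel Ω X := ⟨μ, hμ⟩
  let η : Kernel Ω X := ⟨ν, hν⟩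
  have : IsMarkovKernel κ := ⟨hμp⟩
  have : IsMarkovKernel η := ⟨hνp⟩
  have hcm : ∀ i, Measurable (cand (φ (e i).1) (e i).2.1 (e i).2.2) := fun i => meas_cand (hφ _) _ _
  choose K hK using fun i => exists_kernel κ η (hcm i)
  have hK' : ∀ i c, K i c = ((μ c).prod (ν c)).withDensity
    (dens (cand (φ (e i).1) (e i).2.1 (e i).2.2) (μ c) (ν c)) := hK
  have hcoup : ∀ i c, (K i c).map Prod.fst = μ c ∧ (K i c).map Prod.snd = ν c := by
    intro i c
    rw [hK']
    exact dens_coupling (hcm i) _ _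
  let F : ℕ → Ω → ℝ≥0∞ := fun i c => ∫⁻ z, edist z.1 z.2 ^ p ∂(K i c)
  have mF : ∀ i, Measurable (F i) := fun i => mc.lintegral_kernel
  have happ : ∀ c, ∀ π : Measure (X × X), π.map Prod.fst = μ c → π.map Prod.snd = ν c →
      ⨅ i, F i c ≤ ∫⁻ z, edist z.1 z.2 ^ p ∂π := by
    intro c π h1 h2
    refine ENNReal.le_of_forall_pos_le_add fun ε hε _ => ?_
    obtain ⟨n, k, r, h⟩ := approx2 p hp x₀ φ hφ hφd h1 h2 (hmμ c) (hmν c) ε (by simpa using hε)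
    obtain ⟨i, hi⟩ := he (n, k, r)
    refine (iInf_le _ i).trans ?_
    simp only [F]
    rw [hK', hi]
    exact h
  have hinf : ∀ c, ⨅ i, F i c ≤ ocost p (μ c) (ν c) := fun c =>
    le_iInf₂ fun π hπ => happ c π hπ.1 hπ.2
  refine ENNReal.le_of_forall_pos_le_add fun ε hε htop => ?_
  have hε' : (ε : ℝ≥0∞) ≠ 0 := by simpa using hε.ne'
  have hsel : ∀ c, ∃ i, F i c ≤ (⨅ i, F i c) + ε := by
    intro c
    by_cases ht : ⨅ i, F i c = ∞
    · exact ⟨0, by simp [ht]⟩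
    · obtain ⟨i, hi⟩ := iInf_lt_iff.1 (ENNReal.lt_add_right ht hε')
      exact ⟨i, hi.le⟩
  have msel : Measurable (fun c => Nat.find (hsel c)) :=
    measurable_find hsel fun k => measurableSet_le (mF k) ((Measurable.iInf mF).add_const _)
  let G : Ω → Measure (X × X) := fun c => K (Nat.find (hsel c)) c
  have mG : Measurable G := by
    have : Measurable (fun q : Ω × ℕ => K q.2 q.1) :=
      measurable_from_prod_countable_left fun i => (K i).measurable
    exact this.comp (measurable_id.prodMk msel)
  have hG : ∀ c, ∫⁻ z, edist z.1 z.2 ^ p ∂(G c) ≤ ocost p (μ c) (ν c) + ε := fun c =>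
    (Nat.find_spec (hsel c)).trans (by gcongr; exact hinf c)
  calc ocost p (ρ.bind μ) (ρ.bind ν) ≤ ∫⁻ z, edist z.1 z.2 ^ p ∂(ρ.bind G) := by
        refine iInf₂_le (ρ.bind G) ⟨?_, ?_⟩
        · rw [map_bind' ρ mG measurable_fst]
          congr 1; ext1 c; exact (hcoup _ c).1
        · rw [map_bind' ρ mG measurable_snd]
          congr 1; ext1 c; exact (hcoup _ c).2
    _ = ∫⁻ c, ∫⁻ z, edist z.1 z.2 ^ p ∂(G c) ∂ρ :=
        Measure.lintegral_bind mG.aemeasurable mc.aemeasurable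
    _ ≤ ∫⁻ c, (ocost p (μ c) (ν c) + ε) ∂ρ := lintegral_mono hG
    _ = _ := by rw [lintegral_add_right _ measurable_const]; simp

end metric
end WMix

/-- Mixture `p`-convexity of the `p`-Wasserstein distance: for measurable families
`(μ_c)`, `(ν_c)` of probability measures with finite `p`-th moments over a probability
space `(Ω, ρ)`, one has `W_p(∫ μ_c dρ, ∫ ν_c dρ) ≤ (∫ W_p(μ_c, ν_c)^p dρ)^{1/p}`. -/
theorem wasserstein_mixture_p_convex {X Ω : Type*} [MeasurableSpace Ω]
    [MetricSpace X] [MeasurableSpace X] [BorelSpace X] [PolishSpace X]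
    (p : ℝ) (hp : 1 ≤ p) (ρ : Measure Ω) [IsProbabilityMeasure ρ]
    (μ ν : Ω → Measure X) (hμ : Measurable μ) (hν : Measurable ν)
    (hμp : ∀ c, IsProbabilityMeasure (μ c)) (hνp : ∀ c, IsProbabilityMeasure (ν c))
    (x₀ : X)
    (hmμ : ∀ c, ∫⁻ x, edist x x₀ ^ p ∂(μ c) ≠ ∞)
    (hmν : ∀ c, ∫⁻ x, edist x x₀ ^ p ∂(ν c) ≠ ∞) :
    wassersteinP p (ρ.bind μ) (ρ.bind ν) ≤
      (∫⁻ c, wassersteinP p (μ c) (ν c) ^ p ∂ρ) ^ (1 / p) := by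
  have p0 : p ≠ 0 := by linarith
  have h := WMix.ocost_mix p hp ρ μ ν hμ hν hμp hνp x₀ hmμ hmν
  have e : ∀ a b : Measure X, wassersteinP p a b ^ p = WMix.ocost p a b := by
    intro a b
    unfold wassersteinP WMix.ocost
    rw [← ENNReal.rpow_mul, one_div, inv_mul_cancel₀ p0, ENNReal.rpow_one]
  simp_rw [e]
  exact ENNReal.rpow_le_rpow h (by positivity)
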